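/- Assume G ≅ C_{n1} ⊕ … ⊕ C_{nr} with 1 < n1 | … | nr and D(G) ≥ 4. Let d ∈ Δ1(G) with d ≥ max{⌊nr/2⌋, ⌊(r+1)/2⌋}. If d ≥ r, then ρ*(G, d) = nr/(nr − d). -/

import Mathlib

/- Common definitions: zero-sum sequences over a finite abelian group,
   sets of lengths, the system of sets of lengths, the Davenport constant,
   sets of distances, elasticities, AAPs, Δ₁(G), ρ(G,d,k), ρ(G,d), ρ*(G,d),
   cross numbers, K(G₀), K(G,d), LCN-sets, Δ*(G). -/

open scoped Classical

section Defs

variable {G : Type*} [AddCommGroup G]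

/-- The support of a sequence (multiset) over `G`. -/
def suppSet (A : Multiset G) : Set G := {g | g ∈ A}

/-- `A` is a minimal zero-sum sequence (an atom of `𝓑(G₀)`) over `G₀ ⊆ G`:
a nontrivial zero-sum sequence with terms in `G₀` such that every proper
nontrivial subsequence has nonzero sum. -/
def IsMinZeroSum (G0 : Set G) (A : Multiset G) : Prop :=
  A ≠ 0 ∧ (∀ g ∈ A, g ∈ G0) ∧ A.sum = 0 ∧
    ∀ T : Multiset G, T ≤ A → T.sum = 0 → T = 0 ∨ T = A

/-- `B` is a zero-sum sequence over `G₀ ⊆ G` (an element of `𝓑(G₀)`). -/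
def IsZeroSumSeq (G0 : Set G) (B : Multiset G) : Prop :=
  (∀ g ∈ B, g ∈ G0) ∧ B.sum = 0

/-- The set of lengths `L(B)` of a zero-sum sequence `B` over `G₀`:
all `k` such that `B` is a product of `k` atoms of `𝓑(G₀)`.
(For the trivial sequence this is `{0}`.) -/
def lengthSet (G0 : Set G) (B : Multiset G) : Set ℕ :=
  {k | ∃ U : Fin k → Multiset G, (∀ i, IsMinZeroSum G0 (U i)) ∧ B = ∑ i, U i}

/-- The system of sets of lengths `𝓛(G₀)`. -/
def systemL (G0 : Set G) : Set (Set ℕ) :=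
  {L | ∃ B : Multiset G, IsZeroSumSeq G0 B ∧ L = lengthSet G0 B}

/-- The Davenport constant `D(G)`: the maximal length of a minimal zero-sum
sequence over `G`. -/
noncomputable def davenport (G : Type*) [AddCommGroup G] : ℕ :=
  sSup {m | ∃ A : Multiset G, IsMinZeroSum (Set.univ : Set G) A ∧ Multiset.card A = m}

/-- The set of successive distances `Δ(L)` of a set `L ⊆ ℕ`. -/
def deltaOf (L : Set ℕ) : Set ℕ :=
  {d | 0 < d ∧ ∃ a, a ∈ L ∧ a + d ∈ L ∧ ∀ c ∈ L, ¬(a < c ∧ c < a + d)}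

/-- `Δ(G₀) = ⋃_{L ∈ 𝓛(G₀)} Δ(L)`. -/
def deltaG0 (G0 : Set G) : Set ℕ := ⋃ L ∈ systemL G0, deltaOf L

/-- `Δ*(G) = {min Δ(G₀) : G₀ ⊆ G with Δ(G₀) ≠ ∅}`. -/
def deltaStar (G : Type*) [AddCommGroup G] : Set ℕ :=
  {d | ∃ G0 : Set G, deltaG0 G0 ≠ ∅ ∧ d = sInf (deltaG0 G0)}

/-- The elasticity `ρ(L) = max L / min L` of a (finite) set `L ⊆ ℕ`,
with the convention `ρ({0}) = 1`. -/
noncomputable def rhoL (L : Set ℕ) : ℝ :=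
  if sInf L = 0 then 1 else ((sSup L : ℕ) : ℝ) / ((sInf L : ℕ) : ℝ)

/-- The elasticity `ρ(G₀) = sup {ρ(L) : L ∈ 𝓛(G₀)}`. -/
noncomputable def rhoG0 (G0 : Set G) : ℝ := sSup (rhoL '' systemL G0)

/-- `L` (a set of naturals) is an almost arithmetical progression (AAP)
with difference `d`, length `ℓ` and bound `M`:
`L = y + (L' ∪ {0, d, …, ℓd} ∪ L'') ⊆ y + dℤ` with `L' ⊆ [−M, −1]` and
`L'' ⊆ ℓd + [1, M]`. -/
def IsAAP (L : Set ℕ) (d ℓ M : ℕ) : Prop :=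
  ∃ (y : ℤ) (L1 L2 : Set ℤ),
    L1 ⊆ Set.Icc (-(M : ℤ)) (-1) ∧
    L2 ⊆ Set.Icc ((ℓ : ℤ) * d + 1) ((ℓ : ℤ) * d + M) ∧
    ((fun x : ℕ => (x : ℤ)) '' L) =
      (fun x => y + x) '' (L1 ∪ (fun i : ℤ => (d : ℤ) * i) '' Set.Icc (0 : ℤ) (ℓ : ℤ) ∪ L2) ∧
    (∀ x ∈ L, (d : ℤ) ∣ ((x : ℤ) - y))

/-- `Δ₁(G)`: the set of `d ∈ ℕ` such that for every `k` there is some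
`L ∈ 𝓛(G)` which is an AAP with difference `d` and length at least `k`. -/
def delta1 (G : Type*) [AddCommGroup G] : Set ℕ :=
  {d | 0 < d ∧ ∀ k : ℕ, ∃ L ∈ systemL (Set.univ : Set G), ∃ ℓ ≥ k, ∃ M : ℕ, IsAAP L d ℓ M}

/-- `ρ(G, d, k)`: the supremum of elasticities of sets of lengths of `G` which
are AAPs with difference `d` and length at least `k`. -/
noncomputable def rhoGdk (G : Type*) [AddCommGroup G] (d k : ℕ) : ℝ :=
  sSup (rhoL '' {L | L ∈ systemL (Set.univ : Set G) ∧ ∃ ℓ ≥ k, ∃ M : ℕ, IsAAP L d ℓ M})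

/-- `ρ(G, d)`: the limit of the decreasing sequence `(ρ(G, d, k))_k`,
i.e. its infimum. -/
noncomputable def rhoGd (G : Type*) [AddCommGroup G] (d : ℕ) : ℝ :=
  ⨅ k : ℕ, rhoGdk G d k

/-- `ρ*(G, d) = max {ρ(G₀) : G₀ ⊆ G non-half-factorial with d ∣ min Δ(G₀)}`. -/
noncomputable def rhoStar (G : Type*) [AddCommGroup G] (d : ℕ) : ℝ :=
  sSup {x | ∃ G0 : Set G, deltaG0 G0 ≠ ∅ ∧ d ∣ sInf (deltaG0 G0) ∧ x = rhoG0 G0}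

/-- The cross number `k(S) = Σ_{g ∈ S} 1/ord(g)` of a sequence `S`. -/
noncomputable def crossNum (S : Multiset G) : ℝ :=
  (S.map (fun g => (1 : ℝ) / (addOrderOf g))).sum

/-- `K(G₀) = max {k(A) : A ∈ 𝓐(G₀)}`, the cross number of `G₀`. -/
noncomputable def KG0 (G0 : Set G) : ℝ :=
  sSup {x | ∃ A : Multiset G, IsMinZeroSum G0 A ∧ x = crossNum A}

/-- `K(G, d) = max {K(G₀) : G₀ ⊆ G non-half-factorial with d ∣ min Δ(G₀)}`. -/
noncomputable def KGd (G : Type*) [AddCommGroup G] (d : ℕ) : ℝ :=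
  sSup {x | ∃ G0 : Set G, deltaG0 G0 ≠ ∅ ∧ d ∣ sInf (deltaG0 G0) ∧ x = KG0 G0}

/-- `G₀` is an LCN-set: `k(A) ≥ 1` for every atom `A` of `𝓑(G₀)`. -/
def IsLCN (G0 : Set G) : Prop :=
  ∀ A : Multiset G, IsMinZeroSum G0 A → 1 ≤ crossNum A

end Defs

/-! ### Factorizations -/

set_option linter.unusedSectionVars false

section Aux

variable {G : Type*} [AddCommGroup G]

/-- `F` is a multiset of atoms over `G0`. -/
def AllAtoms (G0 : Set G) (F : Multiset (Multiset G)) : Prop :=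
  ∀ U ∈ F, IsMinZeroSum G0 U

/-- All lengths of factorizations are congruent modulo `d`. -/
def LenCong (G0 : Set G) (d : ℕ) : Prop :=
  ∀ F1 F2 : Multiset (Multiset G), AllAtoms G0 F1 → AllAtoms G0 F2 → F1.sum = F2.sum →
    (d : ℤ) ∣ (Multiset.card F1 : ℤ) - Multiset.card F2

theorem AllAtoms.add {G0 : Set G} {F1 F2 : Multiset (Multiset G)}
    (h1 : AllAtoms G0 F1) (h2 : AllAtoms G0 F2) : AllAtoms G0 (F1 + F2) := by
  intro U hU
  rcases Multiset.mem_add.1 hU with h | h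
  · exact h1 U h
  · exact h2 U h

theorem AllAtoms.nsmul {G0 : Set G} {F : Multiset (Multiset G)}
    (h : AllAtoms G0 F) (k : ℕ) : AllAtoms G0 (k • F) := by
  intro U hU
  exact h U (Multiset.mem_of_mem_nsmul hU)

theorem AllAtoms.sum_zeroSum {G0 : Set G} {F : Multiset (Multiset G)}
    (h : AllAtoms G0 F) : IsZeroSumSeq G0 F.sum := by
  induction F using Multiset.induction_on with
  | empty => simp [IsZeroSumSeq]
  | cons U F ih =>
    have hU := h U (Multiset.mem_cons_self U F)
    have hF : AllAtoms G0 F := fun V hV => h V (Multiset.mem_cons_of_mem hV)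
    obtain ⟨a, b⟩ := ih hF
    rw [Multiset.sum_cons]
    refine ⟨?_, ?_⟩
    · intro g hg
      rcases Multiset.mem_add.1 hg with h | h
      · exact hU.2.1 g h
      · exact a g h
    · rw [Multiset.sum_add, b, hU.2.2.1, add_zero]

theorem mem_lengthSet {G0 : Set G} {B : Multiset G} {k : ℕ} :
    k ∈ lengthSet G0 B ↔ ∃ F, AllAtoms G0 F ∧ F.sum = B ∧ Multiset.card F = k := by
  constructor
  · rintro ⟨U, hU, rfl⟩
    refine ⟨(Finset.univ : Finset (Fin k)).val.map U, ?_, rfl, by simp⟩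
    intro V hV
    obtain ⟨i, -, rfl⟩ := Multiset.mem_map.1 hV
    exact hU i
  · rintro ⟨F, hF, rfl, rfl⟩
    induction F using Quotient.inductionOn with
    | _ l =>
      have hl : ∀ U ∈ l, IsMinZeroSum G0 U := fun U hU => hF U (by simpa using hU)
      refine ⟨fun i => l.get i, fun i => hl _ (List.get_mem l i), ?_⟩
      simp only [Multiset.quot_mk_to_coe, Multiset.sum_coe]
      exact (Fin.sum_univ_getElem l).symm

theorem exists_fac {G0 : Set G} {B : Multiset G} (hB : IsZeroSumSeq G0 B) :
    ∃ F, AllAtoms G0 F ∧ F.sum = B := by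
  induction h : Multiset.card B using Nat.strong_induction_on generalizing B with
  | _ c ih =>
    subst h
    by_cases h0 : B = 0
    · exact ⟨0, by intro U hU; simp at hU, by simp [h0]⟩
    by_cases hat : IsMinZeroSum G0 B
    · refine ⟨{B}, ?_, by simp⟩
      intro U hU
      rw [Multiset.mem_singleton] at hU
      exact hU ▸ hat
    · have : ∃ T ≤ B, T.sum = 0 ∧ T ≠ 0 ∧ T ≠ B := by
        by_contra hcon
        push Not at hcon
        refine hat ⟨h0, hB.1, hB.2, fun T hT hs => ?_⟩
        by_cases hT0 : T = 0
        · exact Or.inl hT0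
        · exact Or.inr (hcon T hT hs hT0)
      obtain ⟨T, hT, hTs, hT0, hTB⟩ := this
      obtain ⟨R, rfl⟩ := Multiset.le_iff_exists_add.1 hT
      have hR0 : R ≠ 0 := by rintro rfl; simp at hTB
      have hRs : R.sum = 0 := by
        have := hB.2
        rw [Multiset.sum_add, hTs, zero_add] at this
        exact this
      have c1 : 0 < Multiset.card T := Multiset.card_pos.2 hT0
      have c2 : 0 < Multiset.card R := Multiset.card_pos.2 hR0
      obtain ⟨F1, hF1, e1⟩ := ih (Multiset.card T) (by simp; omega)
        (B := T) ⟨fun g hg => hB.1 g (Multiset.mem_add.2 (Or.inl hg)), hTs⟩ rfl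
      obtain ⟨F2, hF2, e2⟩ := ih (Multiset.card R) (by simp; omega)
        (B := R) ⟨fun g hg => hB.1 g (Multiset.mem_add.2 (Or.inr hg)), hRs⟩ rfl
      exact ⟨F1 + F2, hF1.add hF2, by rw [Multiset.sum_add, e1, e2]⟩

theorem zs_of_add {G0 : Set G} {A B : Multiset G} (h : IsZeroSumSeq G0 (A + B))
    (hA : A.sum = 0) : IsZeroSumSeq G0 B := by
  refine ⟨fun g hg => h.1 g (Multiset.mem_add.2 (Or.inr hg)), ?_⟩
  have := h.2
  rwa [Multiset.sum_add, hA, zero_add] at this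

theorem IsZeroSumSeq.add {G0 : Set G} {A B : Multiset G} (hA : IsZeroSumSeq G0 A)
    (hB : IsZeroSumSeq G0 B) : IsZeroSumSeq G0 (A + B) := by
  refine ⟨fun g hg => ?_, by rw [Multiset.sum_add, hA.2, hB.2, add_zero]⟩
  rcases Multiset.mem_add.1 hg with h | h
  · exact hA.1 g h
  · exact hB.1 g h

theorem IsMinZeroSum.zs {G0 : Set G} {A : Multiset G} (hA : IsMinZeroSum G0 A) :
    IsZeroSumSeq G0 A := ⟨hA.2.1, hA.2.2.1⟩

theorem card_le_card_sum {G0 : Set G} {F : Multiset (Multiset G)}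
    (h : AllAtoms G0 F) : Multiset.card F ≤ Multiset.card F.sum := by
  induction F using Multiset.induction_on with
  | empty => simp
  | cons U F ih =>
    have hU := h U (Multiset.mem_cons_self U F)
    have hF : AllAtoms G0 F := fun V hV => h V (Multiset.mem_cons_of_mem hV)
    have := ih hF
    have c1 : 0 < Multiset.card U := Multiset.card_pos.2 hU.1
    simp only [Multiset.sum_cons, Multiset.card_cons, Multiset.card_add]
    omega

theorem lengthSet_bdd (G0 : Set G) (B : Multiset G) : BddAbove (lengthSet G0 B) := by
  refine ⟨Multiset.card B, ?_⟩
  intro k hk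
  obtain ⟨F, hF, rfl, rfl⟩ := mem_lengthSet.1 hk
  exact card_le_card_sum hF

theorem le_sum_of_mem_ms {F : Multiset (Multiset G)} {U : Multiset G} (h : U ∈ F) :
    U ≤ F.sum := by
  obtain ⟨F', rfl⟩ := Multiset.exists_cons_of_mem h
  simp

/-- Atoms over a smaller set. -/
theorem IsMinZeroSum.mono {G0 G1 : Set G} {A : Multiset G} (hA : IsMinZeroSum G0 A)
    (h : ∀ g ∈ A, g ∈ G1) : IsMinZeroSum G1 A := ⟨hA.1, h, hA.2.2⟩

/-- The atom `g ^ ord g`. -/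
theorem atom_ord [Finite G] {G0 : Set G} {g : G} (hg : g ∈ G0) :
    IsMinZeroSum G0 (Multiset.replicate (addOrderOf g) g) := by
  have hpos : 0 < addOrderOf g := addOrderOf_pos g
  refine ⟨?_, ?_, ?_, ?_⟩
  · intro h
    have := congrArg Multiset.card h
    rw [Multiset.card_replicate, Multiset.card_zero] at this
    omega
  · intro x hx
    rw [Multiset.eq_of_mem_replicate hx]
    exact hg
  · rw [Multiset.sum_replicate, addOrderOf_nsmul_eq_zero]
  · intro T hT hs
    obtain ⟨k, hk, rfl⟩ := Multiset.le_replicate_iff.1 hT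
    rw [Multiset.sum_replicate] at hs
    have hdv := addOrderOf_dvd_of_nsmul_eq_zero hs
    rcases Nat.eq_zero_or_pos k with h0 | h0
    · left; simp [h0]
    · right
      have := Nat.le_of_dvd h0 hdv
      rw [le_antisymm hk this]

/-- An atom with a term `g` of multiplicity at least `ord g` is `g ^ ord g`. -/
theorem atom_eq_ord [Finite G] {G0 : Set G} {A : Multiset G} (hA : IsMinZeroSum G0 A) {g : G}
    (h : addOrderOf g ≤ A.count g) : A = Multiset.replicate (addOrderOf g) g := by
  have hpos : 0 < addOrderOf g := addOrderOf_pos g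
  rcases hA.2.2.2 _ (Multiset.le_count_iff_replicate_le.1 h)
    (by rw [Multiset.sum_replicate, addOrderOf_nsmul_eq_zero]) with h1 | h1
  · have := congrArg Multiset.card h1
    rw [Multiset.card_replicate, Multiset.card_zero] at this
    omega
  · exact h1.symm

/-- `n` times the cross number. -/
noncomputable def kap (n : ℕ) (S : Multiset G) : ℕ :=
  (S.map (fun g => n / addOrderOf g)).sum

theorem kap_add (n : ℕ) (S T : Multiset G) : kap n (S + T) = kap n S + kap n T := by
  simp [kap]

theorem kap_nsmul (n : ℕ) (k : ℕ) (S : Multiset G) : kap n (k • S) = k * kap n S := by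
  induction k with
  | zero => simp [kap]
  | succ k ih => rw [succ_nsmul, kap_add, ih]; ring

theorem kap_replicate (n k : ℕ) (g : G) :
    kap n (Multiset.replicate k g) = k * (n / addOrderOf g) := by
  simp [kap]

theorem kap_sum (n : ℕ) (F : Multiset (Multiset G)) :
    kap n F.sum = (F.map (kap n)).sum := by
  induction F using Multiset.induction_on with
  | empty => simp [kap]
  | cons U F ih => simp [kap_add, ih]

theorem kap_ord {n : ℕ} (hn : ∀ g : G, n • g = 0) (g : G) :
    kap n (Multiset.replicate (addOrderOf g) g) = n := by
  rw [kap_replicate]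
  exact Nat.mul_div_cancel' (addOrderOf_dvd_of_nsmul_eq_zero (hn g))

theorem kap_fac_eq {n c : ℕ} {F : Multiset (Multiset G)} (h : ∀ U ∈ F, kap n U = c) :
    kap n F.sum = Multiset.card F * c := by
  rw [kap_sum, Multiset.map_congr rfl h]
  simp

theorem kap_fac_ge {n c : ℕ} {F : Multiset (Multiset G)} (h : ∀ U ∈ F, c ≤ kap n U) :
    Multiset.card F * c ≤ kap n F.sum := by
  rw [kap_sum]
  have := Multiset.card_nsmul_le_sum (s := F.map (kap n)) (a := c) (by simpa using h)
  simpa using this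

theorem kap_fac_le {n c : ℕ} {F : Multiset (Multiset G)} (h : ∀ U ∈ F, kap n U ≤ c) :
    kap n F.sum ≤ Multiset.card F * c := by
  rw [kap_sum]
  have := Multiset.sum_le_card_nsmul (F.map (kap n)) c (by simpa using h)
  simpa using this

/-- `A ^ n` is a product of the atoms `g ^ ord g`. -/
theorem npow_fac [Finite G] {n : ℕ} (hn : ∀ g : G, n • g = 0) {G0 : Set G} (A : Multiset G)
    (hA : ∀ g ∈ A, g ∈ G0) :
    ∃ F, AllAtoms G0 F ∧ F.sum = n • A ∧ Multiset.card F = kap n A := by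
  induction A using Multiset.induction_on with
  | empty => exact ⟨0, by intro U hU; simp at hU, by simp, by simp [kap]⟩
  | cons g A ih =>
    obtain ⟨F, h1, h2, h3⟩ := ih (fun x hx => hA x (Multiset.mem_cons_of_mem hx))
    refine ⟨Multiset.replicate (n / addOrderOf g) (Multiset.replicate (addOrderOf g) g) + F,
      ?_, ?_, ?_⟩
    · refine AllAtoms.add ?_ h1
      intro U hU
      rw [Multiset.eq_of_mem_replicate hU]
      exact atom_ord (hA g (Multiset.mem_cons_self g A))
    · rw [Multiset.sum_add, h2, Multiset.sum_replicate, ← Multiset.nsmul_singleton,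
        ← Multiset.singleton_add, nsmul_add, ← mul_nsmul',
        Nat.div_mul_cancel (addOrderOf_dvd_of_nsmul_eq_zero (hn g))]
    · simp [h3, kap]

theorem fac_nsmul {G0 : Set G} {A : Multiset G} (hA : IsMinZeroSum G0 A) (m : ℕ) :
    AllAtoms G0 (Multiset.replicate m A) ∧ (Multiset.replicate m A).sum = m • A := by
  refine ⟨?_, by rw [Multiset.sum_replicate]⟩
  intro U hU
  rw [Multiset.eq_of_mem_replicate hU]
  exact hA

theorem kap_pos [Finite G] {n : ℕ} (hn0 : 0 < n) (hn : ∀ g : G, n • g = 0) (g : G) :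
    0 < n / addOrderOf g :=
  Nat.div_pos (Nat.le_of_dvd hn0 (addOrderOf_dvd_of_nsmul_eq_zero (hn g))) (addOrderOf_pos g)

theorem card_le_kap [Finite G] {n : ℕ} (hn0 : 0 < n) (hn : ∀ g : G, n • g = 0)
    (S : Multiset G) : Multiset.card S ≤ kap n S := by
  have := Multiset.card_nsmul_le_sum (s := S.map (fun g => n / addOrderOf g)) (a := 1)
    (by
      intro x hx
      obtain ⟨g, -, rfl⟩ := Multiset.mem_map.1 hx
      exact kap_pos hn0 hn g)
  simpa [kap] using this

/-! ### Atoms with small cross number -/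

theorem atom_kap_dvd [Finite G] {n d : ℕ} (hn : ∀ g : G, n • g = 0) {G0 : Set G}
    (hL : LenCong G0 d) {A : Multiset G} (hA : IsMinZeroSum G0 A) :
    (d : ℤ) ∣ (n : ℤ) - kap n A := by
  obtain ⟨F, h1, h2, h3⟩ := npow_fac hn A hA.2.1
  have := hL (Multiset.replicate n A) F (fac_nsmul hA n).1 h1 (by rw [(fac_nsmul hA n).2, h2])
  rw [Multiset.card_replicate, h3] at this
  exact this

theorem atom_kap_small [Finite G] {n d : ℕ} (hn1 : 1 < n) (hn : ∀ g : G, n • g = 0)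
    (hdn : n / 2 ≤ d) {G0 : Set G}
    (hL : LenCong G0 d) {A : Multiset G} (hA : IsMinZeroSum G0 A) (hlt : kap n A < n) :
    kap n A + d = n ∧ 2 ≤ kap n A := by
  have h2 : 2 ≤ kap n A := by
    by_contra hcon
    have hc : Multiset.card A ≤ kap n A := card_le_kap (by omega) hn A
    have hc0 : 0 < Multiset.card A := Multiset.card_pos.2 hA.1
    obtain ⟨g, rfl⟩ := Multiset.card_eq_one.1 (by omega : Multiset.card A = 1)
    have h0 : g = 0 := by simpa using hA.2.2.1
    subst h0
    simp [kap] at hlt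
  refine ⟨?_, h2⟩
  obtain ⟨c, hc⟩ := atom_kap_dvd hn hL hA
  have hd0 : 0 < d := by
    have : 1 ≤ n / 2 := by omega
    omega
  have hcpos : 0 < c := by
    by_contra hcon
    have : (d : ℤ) * c ≤ 0 := mul_nonpos_of_nonneg_of_nonpos (by omega) (by omega)
    omega
  have hc1 : c = 1 := by
    by_contra hcon
    have : (d : ℤ) * 2 ≤ d * c := mul_le_mul_of_nonneg_left (by omega) (by omega)
    omega
  subst hc1
  omega

theorem atom_kap_ge [Finite G] {n d : ℕ} (hn1 : 1 < n) (hn : ∀ g : G, n • g = 0)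
    (hdn : n / 2 ≤ d) {G0 : Set G}
    (hL : LenCong G0 d) {A : Multiset G} (hA : IsMinZeroSum G0 A) : n - d ≤ kap n A := by
  by_cases h : kap n A < n
  · have := atom_kap_small hn1 hn hdn hL hA h
    omega
  · omega

theorem int_dvd_gap {d a b : ℕ} (h : (d : ℤ) ∣ (a : ℤ) - b) (hlt : b < a) : b + d ≤ a := by
  have := Int.le_of_dvd (by omega) h
  omega

theorem atom_small_nodup [Finite G] {n d : ℕ} (hn1 : 1 < n) (hn : ∀ g : G, n • g = 0)
    (hdn : n / 2 ≤ d) {G0 : Set G}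
    (hL : LenCong G0 d) {A : Multiset G} (hA : IsMinZeroSum G0 A) (hlt : kap n A < n) :
    A.Nodup := by
  rw [Multiset.nodup_iff_count_le_one]
  intro g
  by_contra hv
  have hd0 : 0 < d := by
    have : 1 ≤ n / 2 := by omega
    omega
  obtain ⟨hk, hk2⟩ := atom_kap_small hn1 hn hdn hL hA hlt
  have hgA : g ∈ A := Multiset.count_pos.1 (by omega)
  have hop : 0 < addOrderOf g := addOrderOf_pos g
  have hon : addOrderOf g ≤ n :=
    Nat.le_of_dvd (by omega) (addOrderOf_dvd_of_nsmul_eq_zero (hn g))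
  -- multiplicity is enough after `m` steps
  set m := (addOrderOf g + 1) / 2 with hm
  have hcov : addOrderOf g ≤ (m • A).count g := by
    rw [Multiset.count_nsmul]
    have : m * 2 ≤ m * A.count g := Nat.mul_le_mul_left m (by omega)
    omega
  obtain ⟨C, hC⟩ := Multiset.le_iff_exists_add.1 (Multiset.le_count_iff_replicate_le.1 hcov)
  have hzs : IsZeroSumSeq G0 (m • A) := by
    rw [← (fac_nsmul hA m).2]
    exact (fac_nsmul hA m).1.sum_zeroSum
  have hCz : IsZeroSumSeq G0 C := by
    rw [hC] at hzs
    exact zs_of_add hzs (by rw [Multiset.sum_replicate, addOrderOf_nsmul_eq_zero])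
  obtain ⟨F, hF, hFs⟩ := exists_fac hCz
  have hgat := atom_ord (hA.2.1 g hgA)
  have hcong := hL (Multiset.replicate m A) ({Multiset.replicate (addOrderOf g) g} + F)
    (fac_nsmul hA m).1
    (AllAtoms.add (by intro U hU; rw [Multiset.mem_singleton] at hU; rw [hU]; exact hgat) hF)
    (by rw [(fac_nsmul hA m).2, Multiset.sum_add, Multiset.sum_singleton, hFs, hC])
  simp only [Multiset.card_replicate, Multiset.card_add, Multiset.card_singleton] at hcong
  have hkap : m * kap n A = n + kap n C := by
    rw [← kap_nsmul, hC, kap_add, kap_ord hn]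
  have hge : Multiset.card F * (n - d) ≤ kap n C := by
    rw [← hFs]
    exact kap_fac_ge (fun U hU => atom_kap_ge hn1 hn hdn hL (hF U hU))
  have hnd : kap n A = n - d := by omega
  have hFm : 1 + Multiset.card F < m := by
    by_contra hcon
    have h1 : m * (n - d) ≤ (1 + Multiset.card F) * (n - d) :=
      Nat.mul_le_mul_right _ (by omega)
    rw [add_mul, one_mul] at h1
    rw [hnd] at hkap
    omega
  have hgap := int_dvd_gap hcong hFm
  -- `F` is nonempty
  have hF0 : 0 < Multiset.card F := by
    rcases Nat.eq_zero_or_pos (Multiset.card F) with h0 | h0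
    · exfalso
      rw [Multiset.card_eq_zero] at h0
      subst h0
      have hC0 : C = 0 := by simpa using hFs.symm
      rw [hC0, add_zero] at hC
      have hAall : ∀ x ∈ A, x = g := by
        intro x hx
        have : x ∈ m • A := by
          rw [Multiset.mem_nsmul]
          exact ⟨by omega, hx⟩
        rw [hC] at this
        exact Multiset.eq_of_mem_replicate this
      have hArep := Multiset.eq_replicate_card.2 hAall
      have hs := hA.2.2.1
      rw [hArep, Multiset.sum_replicate] at hs
      have hdv := addOrderOf_dvd_of_nsmul_eq_zero hs
      have hle := Nat.le_of_dvd (Multiset.card_pos.2 hA.1) hdv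
      have : A = Multiset.replicate (addOrderOf g) g := by
        apply atom_eq_ord hA
        rw [hArep, Multiset.count_replicate_self]
        exact hle
      have hkk : kap n A = n := by
        rw [this, kap_ord hn]
      omega
    · exact h0
  omega


/-! ### A lattice lemma -/

theorem int_subgroup_top (I : AddSubgroup ℤ)
    (h : ∀ p : ℕ, p.Prime → ∃ c ∈ I, ¬ (p : ℤ) ∣ c) : (1 : ℤ) ∈ I := by
  obtain ⟨a, ha⟩ := Int.subgroup_cyclic I
  by_cases h1 : a.natAbs = 1
  · have : a ∈ I := by rw [ha]; exact AddSubgroup.subset_closure rfl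
    rcases Int.natAbs_eq_iff.1 h1 with h2 | h2
    · rw [h2] at this; exact_mod_cast this
    · rw [h2] at this; simpa using I.neg_mem this
  · obtain ⟨p, hp, hpa⟩ := Nat.exists_prime_and_dvd h1
    obtain ⟨c, hc, hpc⟩ := h p hp
    exfalso
    apply hpc
    rw [ha, ← AddSubgroup.zmultiples_eq_closure, AddSubgroup.mem_zmultiples_iff] at hc
    obtain ⟨k, rfl⟩ := hc
    rw [smul_eq_mul]
    exact Dvd.dvd.mul_left (Int.natCast_dvd.2 hpa) k

theorem lattice_lemma {ι : Type*} [Fintype ι] {r : ℕ} (hcard : r + 2 ≤ Fintype.card ι)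
    (ψ : (ι → ℤ) →ₗ[ℤ] (Fin r → ℤ)) (Λ Λ' : AddSubgroup (ι → ℤ))
    (hK : ∀ x, ψ x = 0 → x ∈ Λ) (hΛ : ∀ x ∈ Λ, ∀ i, x i = 0 → x ∈ Λ') : Λ ≤ Λ' := by
  set K := LinearMap.ker ψ with hKdef
  have hrk : 2 ≤ Module.finrank ℤ K := by
    change 2 ≤ Module.finrank ℤ (LinearMap.ker ψ)
    have h1 := Submodule.finrank_quotient_add_finrank (LinearMap.ker ψ)
    rw [LinearEquiv.finrank_eq ψ.quotKerEquivRange] at h1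
    have h2 : Module.finrank ℤ (LinearMap.range ψ) ≤ r := by
      have := Submodule.finrank_le (LinearMap.range ψ)
      simpa using this
    rw [Module.finrank_fintype_fun_eq_card] at h1
    omega
  let b := Module.finBasis ℤ K
  let i0 : Fin (Module.finrank ℤ K) := ⟨0, by omega⟩
  let i1 : Fin (Module.finrank ℤ K) := ⟨1, by omega⟩
  have hne : i0 ≠ i1 := by simp [i0, i1]
  set u : ι → ℤ := (b i0 : ι → ℤ) with hu
  set v : ι → ℤ := (b i1 : ι → ℤ) with hv
  have huK : ψ u = 0 := (b i0).2
  have hvK : ψ v = 0 := (b i1).2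
  have hprim : ∀ (p : ℕ), p.Prime → ∀ α β : ℤ, (∀ i, (p : ℤ) ∣ α * u i + β * v i) →
      (p : ℤ) ∣ α ∧ (p : ℤ) ∣ β := by
    intro p hp α β h
    choose w hw using h
    have hp0 : (p : ℤ) ≠ 0 := by exact_mod_cast hp.ne_zero
    have hwe : (p : ℤ) • w = α • u + β • v := by
      funext i
      simp [hw i]
    have hwK : ψ w = 0 := by
      have : (p : ℤ) • ψ w = 0 := by
        rw [← map_smul, hwe, map_add, map_smul, map_smul, huK, hvK]; simp
      exact (smul_eq_zero.1 this).resolve_left hp0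
    have hwe' : (p : ℤ) • (⟨w, hwK⟩ : K) = α • b i0 + β • b i1 := by
      apply Subtype.ext
      simpa using hwe
    have e0 := congrArg (fun z => b.repr z i0) hwe'
    have e1 := congrArg (fun z => b.repr z i1) hwe'
    simp [hne, hne.symm] at e0 e1
    exact ⟨⟨_, e0.symm⟩, ⟨_, e1.symm⟩⟩
  intro x hx
  let I : AddSubgroup ℤ := Λ'.comap ((smulAddHom ℤ (ι → ℤ)).flip x)
  have hI : ∀ c : ℤ, c ∈ I ↔ c • x ∈ Λ' := fun c => Iff.rfl
  have huL := hK u huK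
  have hvL := hK v hvK
  have hdet : ∀ i j, u i * v j - u j * v i ∈ I := by
    intro i j
    rw [hI]
    have hu' : v j • u - u j • v ∈ Λ' := by
      refine hΛ _ (Λ.sub_mem (Λ.zsmul_mem huL _) (Λ.zsmul_mem hvL _)) j ?_
      simp; ring
    have h2 : (u i * v j - u j * v i) • x - x i • (v j • u - u j • v) ∈ Λ' := by
      refine hΛ _ (Λ.sub_mem (Λ.zsmul_mem hx _) (Λ.zsmul_mem
        (Λ.sub_mem (Λ.zsmul_mem huL _) (Λ.zsmul_mem hvL _)) _)) i ?_
      simp; ring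
    have := Λ'.add_mem h2 (Λ'.zsmul_mem hu' (x i))
    simpa using this
  have h1 : (1 : ℤ) ∈ I := by
    apply int_subgroup_top
    intro p hp
    by_contra hcon
    push Not at hcon
    have hp1 : ¬ (p : ℤ) ∣ 1 := by
      intro h
      exact hp.one_lt.ne' (by exact_mod_cast Int.eq_one_of_dvd_one (by positivity) h)
    have : ∃ i, ¬ (p : ℤ) ∣ u i := by
      by_contra hc
      push Not at hc
      exact hp1 (hprim p hp 1 0 (by simpa using hc)).1
    obtain ⟨i, hi⟩ := this
    have := (hprim p hp (v i) (- u i) (fun j => by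
      have := hcon _ (hdet j i)
      have e : v i * u j + -u i * v j = u j * v i - u i * v j := by ring
      rwa [e])).2
    exact hi ((dvd_neg).1 this)
  simpa using (hI 1).1 h1

/-! ### Products of atoms of cross number one -/

theorem LenCong.mono {G0 G1 : Set G} {d : ℕ} (h : LenCong G0 d) (hs : G1 ⊆ G0) :
    LenCong G1 d := by
  intro F1 F2 h1 h2 he
  exact h F1 F2 (fun U hU => (h1 U hU).mono fun g hg => hs ((h1 U hU).2.1 g hg))
    (fun U hU => (h2 U hU).mono fun g hg => hs ((h2 U hU).2.1 g hg)) he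

/-- `B` is a product of atoms of cross number one. -/
def Good (n : ℕ) (G1 : Set G) (B : Multiset G) : Prop :=
  ∃ P, AllAtoms G1 P ∧ (∀ U ∈ P, kap n U = n) ∧ P.sum = B

theorem Good.add {n : ℕ} {G1 : Set G} {A B : Multiset G} (hA : Good n G1 A)
    (hB : Good n G1 B) : Good n G1 (A + B) := by
  obtain ⟨P, h1, h2, rfl⟩ := hA
  obtain ⟨Q, k1, k2, rfl⟩ := hB
  refine ⟨P + Q, h1.add k1, ?_, Multiset.sum_add _ _⟩
  intro U hU
  rcases Multiset.mem_add.1 hU with h | h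
  · exact h2 U h
  · exact k2 U h

theorem good_miss {n : ℕ} {G1 : Set G}
    (hmiss : ∀ A, IsMinZeroSum G1 A → ∀ g ∈ G1, g ∉ A → kap n A = n)
    {B : Multiset G} (hB : IsZeroSumSeq G1 B) {g : G} (hg : g ∈ G1) (hgB : g ∉ B) :
    Good n G1 B := by
  obtain ⟨P, hP, rfl⟩ := exists_fac hB
  refine ⟨P, hP, fun U hU => hmiss U (hP U hU) g hg ?_, rfl⟩
  intro h
  exact hgB (Multiset.mem_of_le (le_sum_of_mem_ms hU) h)

theorem kap_mono {n : ℕ} {A B : Multiset G} (h : A ≤ B) : kap n A ≤ kap n B := by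
  obtain ⟨C, rfl⟩ := Multiset.le_iff_exists_add.1 h
  rw [kap_add]; omega

theorem good_of_small {n d : ℕ} (hn0 : 0 < n) {G1 : Set G}
    (hb : ∀ A, IsMinZeroSum G1 A → kap n A = n ∨ n * (d + 1) ≤ kap n A)
    {B : Multiset G} (hB : IsZeroSumSeq G1 B) (hk : kap n B ≤ d * n) : Good n G1 B := by
  obtain ⟨P, hP, rfl⟩ := exists_fac hB
  refine ⟨P, hP, fun U hU => ?_, rfl⟩
  rcases hb U (hP U hU) with h | h
  · exact h
  · have := kap_mono (n := n) (le_sum_of_mem_ms hU)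
    have e : n * (d + 1) = d * n + n := by ring
    omega

theorem count_sum_ge {F : Multiset (Multiset G)} {e : G} {c : ℕ}
    (h : ∀ U ∈ F, c ≤ U.count e) : Multiset.card F * c ≤ F.sum.count e := by
  induction F using Multiset.induction_on with
  | empty => simp
  | cons U F ih =>
    have h1 := h U (Multiset.mem_cons_self U F)
    have h2 := ih fun V hV => h V (Multiset.mem_cons_of_mem hV)
    rw [Multiset.sum_cons, Multiset.count_add, Multiset.card_cons, add_mul]
    omega

theorem good_cancel [Finite G] {n d : ℕ} (hn1 : 1 < n) (hn : ∀ g : G, n • g = 0)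
    (hdn : n / 2 ≤ d) {G1 : Set G}
    (hmiss : ∀ A, IsMinZeroSum G1 A → ∀ g ∈ G1, g ∉ A → kap n A = n)
    (hb : ∀ A, IsMinZeroSum G1 A → kap n A = n ∨ n * (d + 1) ≤ kap n A)
    {B : Multiset G} {e : G} (he : e ∈ G1)
    (h : Good n G1 (B + Multiset.replicate (addOrderOf e) e)) : Good n G1 B := by
  obtain ⟨P, hP, hPk, hPs⟩ := h
  have hop : 0 < addOrderOf e := addOrderOf_pos e
  have hon : addOrderOf e ≤ n :=
    Nat.le_of_dvd (by omega) (addOrderOf_dvd_of_nsmul_eq_zero (hn e))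
  have hex : ∃ k, ∃ P', P' ≤ P ∧ addOrderOf e ≤ P'.sum.count e ∧ Multiset.card P' = k := by
    refine ⟨_, P, le_rfl, ?_, rfl⟩
    rw [hPs, Multiset.count_add, Multiset.count_replicate_self]
    omega
  obtain ⟨P', hP'P, hcnt, hcard⟩ := Nat.find_spec hex
  have hmin : ∀ U ∈ P', (P'.erase U).sum.count e < addOrderOf e := by
    intro U hU
    by_contra hcon
    have hlt : Multiset.card (P'.erase U) < Nat.find hex := by
      rw [← hcard]; exact Multiset.card_erase_lt_of_mem hU
    exact Nat.find_min hex hlt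
      ⟨_, (Multiset.erase_le U P').trans hP'P, by omega, rfl⟩
  obtain ⟨B', hB'⟩ := Multiset.le_iff_exists_add.1 (Multiset.le_count_iff_replicate_le.1 hcnt)
  obtain ⟨R, rfl⟩ := Multiset.le_iff_exists_add.1 hP'P
  have hP' : AllAtoms G1 P' := fun U hU => hP U (Multiset.mem_add.2 (Or.inl hU))
  have hR : AllAtoms G1 R := fun U hU => hP U (Multiset.mem_add.2 (Or.inr hU))
  have hBe : B = B' + R.sum := by
    rw [Multiset.sum_add, hB'] at hPs
    have : Multiset.replicate (addOrderOf e) e + (B' + R.sum)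
        = Multiset.replicate (addOrderOf e) e + B := by
      rw [← add_assoc, hPs, add_comm]
    exact (add_left_cancel this).symm
  have hB'z : IsZeroSumSeq G1 B' := by
    have := hP'.sum_zeroSum
    rw [hB'] at this
    exact zs_of_add this (by rw [Multiset.sum_replicate, addOrderOf_nsmul_eq_zero])
  rw [hBe]
  refine Good.add ?_ ⟨R, hR, fun U hU => hPk U (Multiset.mem_add.2 (Or.inr hU)), rfl⟩
  by_cases heB : e ∈ B'
  · have hc1 : 1 ≤ B'.count e := Multiset.one_le_count_iff_mem.2 heB
    have hcs : P'.sum.count e = addOrderOf e + B'.count e := by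
      rw [hB', Multiset.count_add, Multiset.count_replicate_self]
    have h2 : ∀ U ∈ P', 2 ≤ U.count e := by
      intro U hU
      have h1 := hmin U hU
      have h3 : U.count e + (P'.erase U).sum.count e = P'.sum.count e := by
        rw [← Multiset.count_add, ← Multiset.sum_cons, Multiset.cons_erase hU]
      omega
    have hne : P' ≠ 0 := by
      rintro rfl
      simp at hcs
      omega
    obtain ⟨U0, hU0⟩ := Multiset.exists_mem_of_ne_zero hne
    have h4 := count_sum_ge (F := P'.erase U0) (e := e) (c := 2)
      (fun U hU => h2 U (Multiset.mem_of_mem_erase hU))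
    have h5 := hmin U0 hU0
    have h6 : Multiset.card (P'.erase U0) + 1 = Multiset.card P' :=
      Multiset.card_erase_add_one hU0
    have h7 : kap n P'.sum = Multiset.card P' * n :=
      kap_fac_eq fun U hU => hPk U (Multiset.mem_add.2 (Or.inl hU))
    rw [hB', kap_add, kap_ord hn, ← h6, add_mul, one_mul] at h7
    refine good_of_small (by omega) hb hB'z ?_
    have h8 : Multiset.card (P'.erase U0) * n ≤ d * n := Nat.mul_le_mul_right _ (by omega)
    omega
  · exact good_miss hmiss hB'z he heB

/-- The product of the `(g ^ ord g) ^ c_g`. -/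
noncomputable def ordProd {S : Finset G} (c : S → ℕ) : Multiset G :=
  ∑ g : S, c g • Multiset.replicate (addOrderOf (g : G)) (g : G)

theorem count_sum_repl {S : Finset G} (c : S → ℕ) (g : S) :
    (∑ h : S, Multiset.replicate (c h) (h : G)).count (g : G) = c g := by
  rw [Multiset.count_sum', Finset.sum_eq_single g]
  · simp
  · intro b _ hb
    rw [Multiset.count_replicate, if_neg]
    intro h
    exact hb (Subtype.ext h)
  · simp

theorem ordProd_eq {S : Finset G} (c : S → ℕ) :
    ordProd c = ∑ h : S, Multiset.replicate (c h * addOrderOf (h : G)) (h : G) := by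
  unfold ordProd
  refine Finset.sum_congr rfl fun h _ => ?_
  rw [Multiset.nsmul_replicate]

theorem count_ordProd {S : Finset G} (c : S → ℕ) (g : S) :
    (ordProd c).count (g : G) = c g * addOrderOf (g : G) := by
  rw [ordProd_eq, count_sum_repl (fun h => c h * addOrderOf (h : G))]

theorem mem_sum_repl {S : Finset G} (c : S → ℕ) {x : G}
    (hx : x ∈ ∑ h : S, Multiset.replicate (c h) (h : G)) : x ∈ S := by
  rw [Multiset.mem_sum] at hx
  obtain ⟨h, -, hh⟩ := hx
  rw [Multiset.eq_of_mem_replicate hh]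
  exact h.2

theorem ext_of_count {S : Finset G} {A B : Multiset G} (hA : ∀ g ∈ A, g ∈ S)
    (hB : ∀ g ∈ B, g ∈ S) (h : ∀ g : S, A.count (g : G) = B.count (g : G)) : A = B := by
  ext g
  by_cases hg : g ∈ S
  · exact h ⟨g, hg⟩
  · rw [Multiset.count_eq_zero_of_notMem (fun h => hg (hA g h)),
      Multiset.count_eq_zero_of_notMem (fun h => hg (hB g h))]

theorem sum_eq_count {S : Finset G} {A : Multiset G} (hA : ∀ g ∈ A, g ∈ S) :
    A.sum = ∑ g : S, (A.count (g : G)) • (g : G) := by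
  have : A = ∑ h : S, Multiset.replicate (A.count (h : G)) (h : G) :=
    ext_of_count hA (fun g hg => mem_sum_repl _ hg) fun g =>
      (count_sum_repl (fun h : S => A.count (h : G)) g).symm
  conv_lhs => rw [this]
  rw [← Multiset.coe_sumAddMonoidHom, map_sum]
  simp

/-- Exponent vectors that are quotients of good products. -/
def Qv (n : ℕ) (S : Finset G) (x : S → ℤ) : Prop :=
  ∃ (c : S → ℕ) (B : Multiset G), Good n (S : Set G) B ∧
    ∀ g : S, x g + c g * addOrderOf (g : G) = B.count (g : G)

theorem Qv.add {n : ℕ} {S : Finset G} {x y : S → ℤ} (hx : Qv n S x) (hy : Qv n S y) :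
    Qv n S (x + y) := by
  obtain ⟨c, B, h1, h2⟩ := hx
  obtain ⟨c', B', h1', h2'⟩ := hy
  refine ⟨c + c', B + B', h1.add h1', fun g => ?_⟩
  rw [Multiset.count_add]
  push_cast
  rw [← h2, ← h2']
  simp
  ring

theorem Qv_zero (n : ℕ) (S : Finset G) : Qv n S (0 : S → ℤ) :=
  ⟨0, 0, ⟨0, fun U hU => by simp at hU, fun U hU => by simp at hU, by simp⟩, by simp⟩

theorem Qv_of_zero [Finite G] {n : ℕ} {S : Finset G}
    (hmiss : ∀ A, IsMinZeroSum (S : Set G) A → ∀ g ∈ (S : Set G), g ∉ A → kap n A = n)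
    {x : S → ℤ} (hx : ∑ g : S, x g • (g : G) = 0) {i : S} (hi : x i = 0) : Qv n S x := by
  have hpos : ∀ g : S, 0 ≤ x g + (x g).natAbs * addOrderOf (g : G) := by
    intro g
    have h1 : 1 ≤ addOrderOf (g : G) := addOrderOf_pos (g : G)
    have h2 : (x g).natAbs * 1 ≤ (x g).natAbs * addOrderOf (g : G) := Nat.mul_le_mul_left _ h1
    have h3 : ((x g).natAbs : ℤ) ≤ (x g).natAbs * addOrderOf (g : G) := by
      have := Int.ofNat_le.2 h2
      push_cast at this
      simpa using this
    omega
  refine ⟨fun g => (x g).natAbs,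
    ∑ g : S, Multiset.replicate (x g + (x g).natAbs * addOrderOf (g : G)).toNat (g : G),
    ?_, ?_⟩
  · refine good_miss hmiss ⟨fun g hg => mem_sum_repl _ hg, ?_⟩ i.2 ?_
    · rw [← Multiset.coe_sumAddMonoidHom, map_sum]
      simp only [Multiset.coe_sumAddMonoidHom, Multiset.sum_replicate]
      rw [← hx]
      refine Finset.sum_congr rfl fun g _ => ?_
      rw [← natCast_zsmul, Int.toNat_of_nonneg (hpos g), add_zsmul, mul_zsmul,
        natCast_zsmul _ (addOrderOf _), addOrderOf_nsmul_eq_zero, zsmul_zero, add_zero]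
    · rw [← Multiset.count_eq_zero, count_sum_repl
        (fun g : S => (x g + (x g).natAbs * addOrderOf (g : G)).toNat) i, hi]
      simp
  · intro g
    rw [count_sum_repl (fun g : S => (x g + (x g).natAbs * addOrderOf (g : G)).toNat) g,
      Int.toNat_of_nonneg (hpos g)]

theorem kap_ordProd {n : ℕ} (hn : ∀ g : G, n • g = 0) {S : Finset G} (c : S → ℕ) :
    kap n (ordProd c) = (∑ g, c g) * n := by
  have : ∀ T : Finset S, kap n (∑ g ∈ T, c g • Multiset.replicate (addOrderOf (g : G)) (g : G))
      = (∑ g ∈ T, c g) * n := by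
    intro T
    induction T using Finset.induction_on with
    | empty => simp [kap]
    | insert a T ha ih =>
      rw [Finset.sum_insert ha, Finset.sum_insert ha, kap_add, ih, kap_nsmul, kap_ord hn, add_mul]
  exact this Finset.univ

theorem ordProd_fac [Finite G] {S : Finset G} (c : S → ℕ) :
    ∃ F, AllAtoms (S : Set G) F ∧ F.sum = ordProd c ∧ Multiset.card F = ∑ g, c g := by
  have : ∀ T : Finset S, ∃ F, AllAtoms (S : Set G) F ∧
      F.sum = ∑ g ∈ T, c g • Multiset.replicate (addOrderOf (g : G)) (g : G)
      ∧ Multiset.card F = ∑ g ∈ T, c g := by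
    intro T
    induction T using Finset.induction_on with
    | empty => exact ⟨0, fun U hU => by simp at hU, by simp, by simp⟩
    | insert a T ha ih =>
      obtain ⟨F, h1, h2, h3⟩ := ih
      have h4 := fac_nsmul (atom_ord (G0 := (S : Set G)) a.2) (c a)
      refine ⟨_, h4.1.add h1, ?_, ?_⟩
      · rw [Finset.sum_insert ha, Multiset.sum_add, h2, h4.2]
      · rw [Finset.sum_insert ha, Multiset.card_add, h3, Multiset.card_replicate]
  exact this Finset.univ

theorem good_cancel_ordProd [Finite G] {n d : ℕ} (hn1 : 1 < n) (hn : ∀ g : G, n • g = 0)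
    (hdn : n / 2 ≤ d) {S : Finset G}
    (hmiss : ∀ A, IsMinZeroSum (S : Set G) A → ∀ g ∈ (S : Set G), g ∉ A → kap n A = n)
    (hb : ∀ A, IsMinZeroSum (S : Set G) A → kap n A = n ∨ n * (d + 1) ≤ kap n A)
    {B : Multiset G} (c : S → ℕ)
    (h : Good n (S : Set G) (B + ordProd c)) : Good n (S : Set G) B := by
  have h1 : ∀ (e : S) (k : ℕ) (C : Multiset G),
      Good n (S : Set G) (C + k • Multiset.replicate (addOrderOf (e : G)) (e : G)) →
      Good n (S : Set G) C := by
    intro e k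
    induction k with
    | zero => intro C hC; simpa using hC
    | succ k ih =>
      intro C hC
      rw [succ_nsmul, ← add_assoc] at hC
      exact ih C (good_cancel hn1 hn hdn hmiss hb e.2 hC)
  have h2 : ∀ (T : Finset S) (C : Multiset G),
      Good n (S : Set G)
        (C + ∑ g ∈ T, c g • Multiset.replicate (addOrderOf (g : G)) (g : G)) →
      Good n (S : Set G) C := by
    intro T
    induction T using Finset.induction_on with
    | empty => intro C hC; simpa using hC
    | insert a T ha ih =>
      intro C hC
      rw [Finset.sum_insert ha, ← add_assoc] at hC
      exact h1 a _ C (ih _ hC)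
  exact h2 _ B h

theorem core_big [Finite G] {n d r : ℕ} (hn1 : 1 < n) (hn : ∀ g : G, n • g = 0)
    (hdn : n / 2 ≤ d) {S : Finset G} (hL : LenCong (S : Set G) d)
    (hmiss : ∀ A, IsMinZeroSum (S : Set G) A → ∀ g ∈ (S : Set G), g ∉ A → kap n A = n)
    (hge : ∀ A, IsMinZeroSum (S : Set G) A → n ≤ kap n A)
    (hcard : r + 2 ≤ S.card)
    (ψ : (S → ℤ) →ₗ[ℤ] (Fin r → ℤ)) (hψ : ∀ x, ψ x = 0 → ∑ g : S, x g • (g : G) = 0)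
    {W : Multiset G} (hW : IsMinZeroSum (S : Set G) W) : kap n W = n := by
  let Λ : AddSubgroup (S → ℤ) :=
    { carrier := {x | ∑ g : S, x g • (g : G) = 0}
      zero_mem' := by simp
      add_mem' := by
        intro a b ha hb
        have ha' : ∑ g : S, a g • (g : G) = 0 := ha
        have hb' : ∑ g : S, b g • (g : G) = 0 := hb
        change ∑ g : S, (a g + b g) • (g : G) = 0
        simp only [add_zsmul, Finset.sum_add_distrib, ha', hb', add_zero]
      neg_mem' := by
        intro a ha
        have ha' : ∑ g : S, a g • (g : G) = 0 := ha
        change ∑ g : S, (- a g) • (g : G) = 0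
        simp only [neg_zsmul, Finset.sum_neg_distrib, ha', neg_zero] }
  let Λ' : AddSubgroup (S → ℤ) :=
    { carrier := {x | Qv n S x ∧ Qv n S (-x)}
      zero_mem' := ⟨Qv_zero n S, by rw [neg_zero]; exact Qv_zero n S⟩
      add_mem' := by
        intro a b ha hb
        exact ⟨ha.1.add hb.1, by rw [neg_add]; exact ha.2.add hb.2⟩
      neg_mem' := by
        intro a ha
        exact ⟨ha.2, by rw [neg_neg]; exact ha.1⟩ }
  have hle : Λ ≤ Λ' := by
    refine lattice_lemma (by simpa using hcard) ψ Λ Λ' hψ ?_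
    intro x hx i hi
    have hx' : ∑ g : S, x g • (g : G) = 0 := hx
    exact ⟨Qv_of_zero hmiss hx' hi, Qv_of_zero hmiss (i := i) (by
      simp only [Pi.neg_apply, neg_zsmul, Finset.sum_neg_distrib, hx', neg_zero]) (by simp [hi])⟩
  have hQ : ∀ A, IsMinZeroSum (S : Set G) A →
      ∃ c : S → ℕ, Good n (S : Set G) (A + ordProd c) := by
    intro A hA
    have hmem : (fun g : S => (A.count (g : G) : ℤ)) ∈ Λ := by
      change ∑ g : S, (A.count (g : G) : ℤ) • (g : G) = 0
      simp only [natCast_zsmul]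
      rw [← sum_eq_count (fun g hg => by simpa using hA.2.1 g hg)]
      exact hA.2.2.1
    obtain ⟨c, B, hB, hc⟩ := (hle hmem).1
    refine ⟨c, ?_⟩
    have : A + ordProd c = B := by
      refine ext_of_count (S := S) ?_ ?_ ?_
      · intro g hg
        rcases Multiset.mem_add.1 hg with h | h
        · simpa using hA.2.1 g h
        · rw [ordProd_eq] at h
          exact mem_sum_repl _ h
      · obtain ⟨P, hP, -, rfl⟩ := hB
        intro g hg
        simpa using hP.sum_zeroSum.1 g hg
      · intro g
        rw [Multiset.count_add, count_ordProd]
        have := hc g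
        beta_reduce at this
        exact_mod_cast this
    rwa [this]
  have hb : ∀ A, IsMinZeroSum (S : Set G) A → kap n A = n ∨ n * (d + 1) ≤ kap n A := by
    intro A hA
    obtain ⟨c, P, hP, hPk, hPs⟩ := hQ A hA
    have hk := kap_fac_eq hPk
    rw [hPs, kap_add, kap_ordProd hn] at hk
    obtain ⟨F, hF, hFs, hFc⟩ := ordProd_fac c
    have hcong := hL P ({A} + F) hP
      (AllAtoms.add (by intro U hU; rw [Multiset.mem_singleton] at hU; rw [hU]; exact hA) hF)
      (by rw [hPs, Multiset.sum_add, Multiset.sum_singleton, hFs])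
    rw [Multiset.card_add, hFc, Multiset.card_singleton] at hcong
    have hgeA := hge A hA
    rcases lt_trichotomy (Multiset.card P) (1 + ∑ g, c g) with h | h | h
    · exfalso
      have : Multiset.card P * n ≤ (∑ g, c g) * n := Nat.mul_le_mul_right _ (by omega)
      omega
    · left
      rw [h, add_mul, one_mul] at hk
      omega
    · right
      have h1 := int_dvd_gap hcong h
      have : (1 + ∑ g, c g + d) * n ≤ Multiset.card P * n := Nat.mul_le_mul_right _ h1
      have e : (1 + ∑ g, c g + d) * n = n * (d + 1) + (∑ g, c g) * n := by ring
      omega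
  obtain ⟨c, hc⟩ := hQ W hW
  obtain ⟨P, hP, hPk, hPs⟩ := good_cancel_ordProd hn1 hn hdn hmiss hb c hc
  have hne : P ≠ 0 := by
    rintro rfl
    exact hW.1 (by simpa using hPs.symm)
  obtain ⟨U, hU⟩ := Multiset.exists_mem_of_ne_zero hne
  have hUW : U ≤ W := hPs ▸ le_sum_of_mem_ms hU
  rcases hW.2.2.2 U hUW (hP U hU).2.2.1 with h | h
  · exact absurd h (hP U hU).1
  · rw [← h]; exact hPk U hU

/-! ### Cross numbers are at most one -/

theorem atom_kap_le [Finite G] {n d r : ℕ} (hn1 : 1 < n) (hn : ∀ g : G, n • g = 0)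
    (hdn : n / 2 ≤ d) (hrd : r ≤ d) (γ : G → Fin r → ℤ)
    (hγ : ∀ (S : Finset G) (x : S → ℤ), (∀ j, ∑ g : S, x g * γ g j = 0) →
      ∑ g : S, x g • (g : G) = 0)
    {G0 : Set G} (hL : LenCong G0 d) {W : Multiset G} (hW : IsMinZeroSum G0 W) :
    kap n W ≤ n := by
  induction hc : W.toFinset.card using Nat.strong_induction_on generalizing W with
  | _ m ih =>
    subst hc
    by_contra hgt
    push Not at hgt
    set S : Finset G := W.toFinset with hS
    have hSG : (S : Set G) ⊆ G0 := by
      intro g hg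
      exact hW.2.1 g (by simpa [hS] using hg)
    have hLS : LenCong (S : Set G) d := hL.mono hSG
    have hup : ∀ A, IsMinZeroSum (S : Set G) A → IsMinZeroSum G0 A :=
      fun A hA => hA.mono fun g hg => hSG (hA.2.1 g hg)
    have hWS : IsMinZeroSum (S : Set G) W := hW.mono fun g hg => by simpa [hS] using hg
    have hge : ∀ A, IsMinZeroSum (S : Set G) A → n ≤ kap n A := by
      intro A hA
      by_contra hlt
      push Not at hlt
      have hnd := atom_small_nodup hn1 hn hdn hLS hA hlt
      have hAW : A ≤ W := by
        rw [Multiset.le_iff_subset hnd]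
        intro g hg
        have := hA.2.1 g hg
        simpa [hS] using this
      rcases hW.2.2.2 A hAW hA.2.2.1 with h | h
      · exact hA.1 h
      · rw [h] at hlt; omega
    have hmiss : ∀ A, IsMinZeroSum (S : Set G) A → ∀ g ∈ (S : Set G), g ∉ A → kap n A = n := by
      intro A hA g hg hgA
      refine le_antisymm (ih _ ?_ (hup A hA) rfl) (hge A hA)
      apply Finset.card_lt_card
      rw [Finset.ssubset_iff_of_subset]
      · exact ⟨g, hg, by simpa using hgA⟩
      · intro x hx
        exact hA.2.1 x (by simpa using hx)
    have hcnt : ∀ g, W.count g < addOrderOf g := by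
      intro g
      by_contra hcon
      push Not at hcon
      have := atom_eq_ord hW hcon
      rw [this, kap_ord hn] at hgt
      omega
    by_cases hm : S.card ≤ d + 1
    · have hle : W ≤ ordProd (fun _ : S => 1) := by
        rw [Multiset.le_iff_count]
        intro g
        by_cases hg : g ∈ S
        · rw [count_ordProd (fun _ : S => 1) ⟨g, hg⟩, one_mul]
          exact (hcnt g).le
        · rw [Multiset.count_eq_zero_of_notMem (fun h => hg (by simpa [hS] using h))]
          omega
      obtain ⟨D, hD⟩ := Multiset.le_iff_exists_add.1 hle
      obtain ⟨F', hF', hF's, hF'c⟩ := ordProd_fac (fun _ : S => 1)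
      have hDz : IsZeroSumSeq (S : Set G) D := by
        have := hF'.sum_zeroSum
        rw [hF's, hD] at this
        exact zs_of_add this hW.2.2.1
      obtain ⟨F, hF, hFs⟩ := exists_fac hDz
      have hcong := hLS F' ({W} + F) hF'
        (AllAtoms.add (by intro U hU; rw [Multiset.mem_singleton] at hU; rw [hU]; exact hWS) hF)
        (by rw [hF's, hD, Multiset.sum_add, Multiset.sum_singleton, hFs])
      have hone : ∑ _g : S, 1 = S.card := by simp
      have hk := kap_ordProd hn (fun _ : S => 1)
      rw [hD, kap_add, hone] at hk
      rw [hF'c, Multiset.card_add, Multiset.card_singleton, hone] at hcong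
      have hFk : Multiset.card F * n ≤ kap n D := by
        rw [← hFs]
        exact kap_fac_ge fun U hU => hge U (hF U hU)
      have hlt : 1 + Multiset.card F < S.card := by
        by_contra hcon
        have : S.card * n ≤ (1 + Multiset.card F) * n := Nat.mul_le_mul_right _ (by omega)
        rw [add_mul, one_mul] at this
        omega
      have hgap := int_dvd_gap hcong hlt
      have hF0 : F = 0 := Multiset.card_eq_zero.1 (by omega)
      rw [hF0, Multiset.sum_zero] at hFs
      rw [← hFs, add_zero] at hD
      obtain ⟨g, hg⟩ := Multiset.exists_mem_of_ne_zero hW.1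
      have h1 := hcnt g
      rw [← hD, count_ordProd (fun _ : S => 1) ⟨g, by simpa [hS] using hg⟩] at h1
      simp at h1
    · let ψ : (S → ℤ) →ₗ[ℤ] (Fin r → ℤ) :=
        { toFun := fun x j => ∑ g : S, x g * γ g j
          map_add' := by
            intro x y
            funext j
            simp only [Pi.add_apply, add_mul, Finset.sum_add_distrib]
          map_smul' := by
            intro c x
            funext j
            simp only [Pi.smul_apply, smul_eq_mul, mul_assoc, Finset.mul_sum, RingHom.id_apply] }
      have := core_big (r := r) hn1 hn hdn hLS hmiss hge (by omega) ψ
        (fun x hx => hγ S x fun j => congrFun hx j) hWS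
      omega

/-! ### Distances -/

theorem mem_deltaG0 {G0 : Set G} {δ : ℕ} : δ ∈ deltaG0 G0 ↔
    ∃ B, IsZeroSumSeq G0 B ∧ δ ∈ deltaOf (lengthSet G0 B) := by
  unfold deltaG0 systemL
  simp only [Set.mem_iUnion]
  constructor
  · rintro ⟨L, ⟨B, hB, rfl⟩, h⟩
    exact ⟨B, hB, h⟩
  · rintro ⟨B, hB, h⟩
    exact ⟨_, ⟨B, hB, rfl⟩, h⟩

theorem exists_dist {G0 : Set G} {F1 F2 : Multiset (Multiset G)} (h1 : AllAtoms G0 F1)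
    (h2 : AllAtoms G0 F2) (he : F1.sum = F2.sum) (hlt : Multiset.card F1 < Multiset.card F2) :
    ∃ δ ∈ deltaG0 G0, Multiset.card F1 + δ ≤ Multiset.card F2 := by
  set L := lengthSet G0 F1.sum with hLdef
  have m1 : Multiset.card F1 ∈ L := mem_lengthSet.2 ⟨F1, h1, rfl, rfl⟩
  have m2 : Multiset.card F2 ∈ L := mem_lengthSet.2 ⟨F2, h2, he.symm, rfl⟩
  have hex : ∃ k, 0 < k ∧ Multiset.card F1 + k ∈ L :=
    ⟨Multiset.card F2 - Multiset.card F1, by omega, by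
      rwa [Nat.add_sub_cancel' hlt.le]⟩
  obtain ⟨hp, hm⟩ := Nat.find_spec hex
  refine ⟨Nat.find hex, mem_deltaG0.2 ⟨F1.sum, h1.sum_zeroSum, hp, _, m1, hm, ?_⟩, ?_⟩
  · rintro c hc ⟨hc1, hc2⟩
    refine Nat.find_min hex (m := c - Multiset.card F1) (by omega) ⟨by omega, ?_⟩
    rwa [Nat.add_sub_cancel' hc1.le]
  · have := Nat.find_min' hex (m := Multiset.card F2 - Multiset.card F1)
      ⟨by omega, by rwa [Nat.add_sub_cancel' hlt.le]⟩
    omega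

theorem delta_fac {G0 : Set G} {δ : ℕ} (h : δ ∈ deltaG0 G0) :
    0 < δ ∧ ∃ F1 F2, AllAtoms G0 F1 ∧ AllAtoms G0 F2 ∧ F1.sum = F2.sum ∧
      Multiset.card F1 = Multiset.card F2 + δ := by
  obtain ⟨B, -, h0, a, ha, hb, -⟩ := mem_deltaG0.1 h
  obtain ⟨F2, h1, h2, h3⟩ := mem_lengthSet.1 ha
  obtain ⟨F1, k1, k2, k3⟩ := mem_lengthSet.1 hb
  exact ⟨h0, F1, F2, k1, h1, k2.trans h2.symm, by omega⟩

theorem dvd_of_lenCong {G0 : Set G} {d : ℕ} (hL : LenCong G0 d) (hne : deltaG0 G0 ≠ ∅) :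
    d ∣ sInf (deltaG0 G0) := by
  obtain ⟨-, F1, F2, h1, h2, h3, h4⟩ :=
    delta_fac (Nat.sInf_mem (Set.nonempty_iff_ne_empty.2 hne))
  have := hL F1 F2 h1 h2 h3
  rw [h4] at this
  push_cast at this
  rw [add_sub_cancel_left] at this
  exact_mod_cast this

theorem lenCong_sInf {G0 : Set G} (hne : deltaG0 G0 ≠ ∅) : LenCong G0 (sInf (deltaG0 G0)) := by
  have hmem := Nat.sInf_mem (Set.nonempty_iff_ne_empty.2 hne)
  obtain ⟨hpos, F1, F2, h1, h2, h3, h4⟩ := delta_fac hmem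
  set δ := sInf (deltaG0 G0) with hδ
  let I : AddSubgroup ℤ :=
    { carrier := {z | ∃ F1 F2, AllAtoms G0 F1 ∧ AllAtoms G0 F2 ∧ F1.sum = F2.sum ∧
        z = (Multiset.card F1 : ℤ) - Multiset.card F2}
      zero_mem' := ⟨0, 0, fun U hU => by simp at hU, fun U hU => by simp at hU, rfl, by simp⟩
      add_mem' := by
        rintro a b ⟨A1, A2, a1, a2, a3, rfl⟩ ⟨B1, B2, b1, b2, b3, rfl⟩
        refine ⟨A1 + B1, A2 + B2, a1.add b1, a2.add b2, ?_, ?_⟩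
        · rw [Multiset.sum_add, Multiset.sum_add, a3, b3]
        · rw [Multiset.card_add, Multiset.card_add]; push_cast; ring
      neg_mem' := by
        rintro a ⟨A1, A2, a1, a2, a3, rfl⟩
        exact ⟨A2, A1, a2, a1, a3.symm, by ring⟩ }
  have hδI : (δ : ℤ) ∈ I := ⟨F1, F2, h1, h2, h3, by rw [h4]; push_cast; ring⟩
  intro A1 A2 a1 a2 a3
  set z : ℤ := (Multiset.card A1 : ℤ) - Multiset.card A2 with hz
  have hzI : z ∈ I := ⟨A1, A2, a1, a2, a3, rfl⟩
  have hmod : z % δ ∈ I := by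
    rw [Int.emod_def]
    refine I.sub_mem hzI ?_
    have := I.zsmul_mem hδI (z / δ)
    rwa [smul_eq_mul, mul_comm] at this
  have hlt : z % δ < δ := Int.emod_lt_of_pos z (by omega)
  have hnn : 0 ≤ z % δ := Int.emod_nonneg z (by omega)
  obtain ⟨B1, B2, b1, b2, b3, b4⟩ := hmod
  apply Int.dvd_of_emod_eq_zero
  by_contra hne0
  obtain ⟨ε, hε, hle⟩ := exists_dist b2 b1 b3.symm (by omega)
  have : δ ≤ ε := Nat.sInf_le hε
  omega

theorem lenCong_of_dvd {G0 : Set G} {d : ℕ} (hne : deltaG0 G0 ≠ ∅)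
    (hd : d ∣ sInf (deltaG0 G0)) : LenCong G0 d := by
  intro F1 F2 h1 h2 h3
  exact (Int.natCast_dvd_natCast.2 hd).trans (lenCong_sInf hne F1 F2 h1 h2 h3)

theorem exists_small {n : ℕ} (hn0 : 0 < n) {G0 : Set G} (hne : deltaG0 G0 ≠ ∅)
    (hle : ∀ A, IsMinZeroSum G0 A → kap n A ≤ n) : ∃ A, IsMinZeroSum G0 A ∧ kap n A < n := by
  by_contra hcon
  push Not at hcon
  obtain ⟨δ, hδ⟩ := Set.nonempty_iff_ne_empty.2 hne
  obtain ⟨h0, F1, F2, h1, h2, h3, h4⟩ := delta_fac hδ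
  have e1 := kap_fac_eq (n := n) (c := n) (F := F1)
    fun U hU => le_antisymm (hle U (h1 U hU)) (hcon U (h1 U hU))
  have e2 := kap_fac_eq (n := n) (c := n) (F := F2)
    fun U hU => le_antisymm (hle U (h2 U hU)) (hcon U (h2 U hU))
  rw [h3, e2] at e1
  have := Nat.eq_of_mul_eq_mul_right hn0 e1
  omega

/-! ### Elasticity -/

theorem rho_eq [Finite G] {n d : ℕ} (hn1 : 1 < n) (hn : ∀ g : G, n • g = 0)
    (hdn : n / 2 ≤ d) {G0 : Set G} (hL : LenCong G0 d) (hne : deltaG0 G0 ≠ ∅)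
    (hle : ∀ A, IsMinZeroSum G0 A → kap n A ≤ n) :
    rhoG0 G0 = (n : ℝ) / ((n : ℝ) - (d : ℝ)) := by
  obtain ⟨A, hA, hlt⟩ := exists_small (by omega) hne hle
  obtain ⟨hAd, hA2⟩ := atom_kap_small hn1 hn hdn hL hA hlt
  have hge : ∀ A, IsMinZeroSum G0 A → n - d ≤ kap n A :=
    fun A hA => atom_kap_ge hn1 hn hdn hL hA
  have hkA : kap n A = n - d := by omega
  have hcast : (n : ℝ) - (d : ℝ) = ((n - d : ℕ) : ℝ) := by
    rw [Nat.cast_sub (by omega)]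
  rw [hcast]
  have hpos : (0 : ℝ) < ((n - d : ℕ) : ℝ) := by exact_mod_cast (by omega : 0 < n - d)
  have hbound : ∀ B, ∀ k ∈ lengthSet G0 B, k * (n - d) ≤ kap n B ∧ kap n B ≤ k * n := by
    intro B k hk
    obtain ⟨F, hF, rfl, rfl⟩ := mem_lengthSet.1 hk
    exact ⟨kap_fac_ge fun U hU => hge U (hF U hU), kap_fac_le fun U hU => hle U (hF U hU)⟩
  refine IsGreatest.csSup_eq ⟨?_, ?_⟩
  · refine ⟨lengthSet G0 (n • A), ⟨n • A, ?_, rfl⟩, ?_⟩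
    · rw [← (fac_nsmul hA n).2]
      exact (fac_nsmul hA n).1.sum_zeroSum
    · obtain ⟨F, f1, f2, f3⟩ := npow_fac hn A hA.2.1
      have m1 : n ∈ lengthSet G0 (n • A) :=
        mem_lengthSet.2 ⟨_, (fac_nsmul hA n).1, (fac_nsmul hA n).2, by simp⟩
      have m2 : n - d ∈ lengthSet G0 (n • A) := mem_lengthSet.2 ⟨F, f1, f2, by omega⟩
      have hk : kap n (n • A) = n * (n - d) := by rw [kap_nsmul, hkA]
      have s1 : sSup (lengthSet G0 (n • A)) = n := by
        refine IsGreatest.csSup_eq ⟨m1, fun k hk' => ?_⟩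
        have := (hbound _ k hk').1
        rw [hk] at this
        exact Nat.le_of_mul_le_mul_right this (by omega)
      have s2 : sInf (lengthSet G0 (n • A)) = n - d := by
        refine IsLeast.csInf_eq ⟨m2, fun k hk' => ?_⟩
        have := (hbound _ k hk').2
        rw [hk, mul_comm] at this
        exact Nat.le_of_mul_le_mul_right this (by omega)
      unfold rhoL
      rw [s1, s2, if_neg (by omega)]
  · rintro _ ⟨_, ⟨B, hB, rfl⟩, rfl⟩
    unfold rhoL
    split_ifs with h0
    · rw [le_div_iff₀ hpos, one_mul]
      exact_mod_cast Nat.sub_le n d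
    · obtain ⟨F, hF, hFs⟩ := exists_fac hB
      have hne' : (lengthSet G0 B).Nonempty := ⟨_, mem_lengthSet.2 ⟨F, hF, hFs, rfl⟩⟩
      have b1 := (hbound B _ (Nat.sSup_mem hne' (lengthSet_bdd G0 B))).1
      have b2 := (hbound B _ (Nat.sInf_mem hne')).2
      rw [div_le_div_iff₀ (by exact_mod_cast Nat.pos_of_ne_zero h0) hpos]
      have := b1.trans b2
      rw [mul_comm _ n] at this
      exact_mod_cast this

/-! ### The set `Δ₁` -/

theorem card_bad_le {G0 : Set G} {F : Multiset (Multiset G)}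
    (h : ∀ U ∈ F, ∃ g ∈ U, g ∉ G0) :
    Multiset.card F ≤ Multiset.card (F.sum.filter (fun g => g ∉ G0)) := by
  induction F using Multiset.induction_on with
  | empty => simp
  | cons U F ih =>
    obtain ⟨g, hg, hg0⟩ := h U (Multiset.mem_cons_self U F)
    have h2 := ih fun V hV => h V (Multiset.mem_cons_of_mem hV)
    have h3 : 0 < Multiset.card (U.filter (fun g => g ∉ G0)) :=
      Multiset.card_pos_iff_exists_mem.2 ⟨g, Multiset.mem_filter.2 ⟨hg, hg0⟩⟩
    rw [Multiset.sum_cons, Multiset.filter_add, Multiset.card_add, Multiset.card_cons]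
    omega

theorem atom_kap_bound [Fintype G] {n : ℕ} (hn : ∀ g : G, n • g = 0) {G0 : Set G}
    {U : Multiset G} (hU : IsMinZeroSum G0 U) : kap n U ≤ Fintype.card G * n := by
  have hle : U ≤ ordProd (S := (Finset.univ : Finset G)) (fun _ => 1) := by
    rw [Multiset.le_iff_count]
    intro g
    rw [count_ordProd (S := (Finset.univ : Finset G)) (fun _ => 1) ⟨g, Finset.mem_univ g⟩,
      one_mul]
    by_contra hcon
    push Not at hcon
    have := atom_eq_ord hU hcon.le
    rw [this] at hcon
    simp at hcon
  have := kap_mono (n := n) hle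
  rw [kap_ordProd hn] at this
  simpa using this

theorem exists_of_delta1 [Fintype G] {n d : ℕ} (hn1 : 1 < n) (hn : ∀ g : G, n • g = 0)
    (hd : d ∈ delta1 G) : ∃ G0 : Set G, deltaG0 G0 ≠ ∅ ∧ LenCong G0 d := by
  obtain ⟨hd0, hd⟩ := hd
  have hkey : ∀ k : ℕ, ∃ B : Multiset G,
      (∀ F1 F2, AllAtoms Set.univ F1 → AllAtoms Set.univ F2 → F1.sum = B → F2.sum = B →
        (d : ℤ) ∣ (Multiset.card F1 : ℤ) - Multiset.card F2) ∧
      ∃ F1 F2, AllAtoms Set.univ F1 ∧ AllAtoms Set.univ F2 ∧ F1.sum = B ∧ F2.sum = B ∧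
        Multiset.card F1 + k ≤ Multiset.card F2 := by
    intro k
    obtain ⟨L, ⟨B, hB, rfl⟩, ℓ, hℓ, M, y, L1, L2, -, -, hLeq, hcong⟩ := hd k
    refine ⟨B, ?_, ?_⟩
    · intro F1 F2 h1 h2 e1 e2
      have c1 := hcong _ (mem_lengthSet.2 ⟨F1, h1, e1, rfl⟩)
      have c2 := hcong _ (mem_lengthSet.2 ⟨F2, h2, e2, rfl⟩)
      have := dvd_sub c1 c2
      rwa [sub_sub_sub_cancel_right] at this
    · have hin : ∀ i : ℤ, 0 ≤ i → i ≤ ℓ → ∃ F, AllAtoms Set.univ F ∧ F.sum = B ∧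
          (Multiset.card F : ℤ) = y + d * i := by
        intro i h0 h1
        have : y + d * i ∈ (fun x : ℕ => (x : ℤ)) '' lengthSet Set.univ B := by
          rw [hLeq]
          exact ⟨d * i, Or.inl (Or.inr ⟨i, ⟨h0, h1⟩, rfl⟩), rfl⟩
        obtain ⟨x, hx, hxe⟩ := this
        obtain ⟨F, f1, f2, f3⟩ := mem_lengthSet.1 hx
        refine ⟨F, f1, f2, ?_⟩
        rw [f3]; exact hxe
      obtain ⟨F1, a1, a2, a3⟩ := hin 0 le_rfl (by omega)
      obtain ⟨F2, b1, b2, b3⟩ := hin ℓ (by omega) le_rfl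
      refine ⟨F1, F2, a1, b1, a2, b2, ?_⟩
      have hdl : (ℓ : ℤ) ≤ d * ℓ := by
        have : 1 * ℓ ≤ d * ℓ := Nat.mul_le_mul_right ℓ hd0
        rw [one_mul] at this
        exact_mod_cast this
      rw [mul_zero] at a3
      omega
  choose B hBc hBs using hkey
  let 𝒰 : Ultrafilter ℕ := Filter.hyperfilter ℕ
  let G0 : Set G := {g | ∀ c, ∀ᶠ k in (𝒰 : Filter ℕ), c ≤ (B k).count g}
  have hL : LenCong G0 d := by
    intro F1 F2 h1 h2 he
    have hev : ∀ᶠ k in (𝒰 : Filter ℕ), ∀ g, F1.sum.count g ≤ (B k).count g := by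
      rw [Filter.eventually_all]
      intro g
      by_cases hg : g ∈ G0
      · exact hg _
      · rw [Multiset.count_eq_zero_of_notMem (fun h => hg (h1.sum_zeroSum.1 g h))]
        exact Filter.Eventually.of_forall fun _ => Nat.zero_le _
    obtain ⟨k, hk⟩ := hev.exists
    obtain ⟨R, hR⟩ := Multiset.le_iff_exists_add.1 (Multiset.le_iff_count.2 hk)
    have up : ∀ F, AllAtoms G0 F → AllAtoms Set.univ F :=
      fun F hF U hU => (hF U hU).mono fun _ _ => Set.mem_univ _
    obtain ⟨A1, A2, a1, -, a2, -⟩ := hBs k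
    have hBz : IsZeroSumSeq Set.univ (B k) := a2 ▸ a1.sum_zeroSum
    have hRz : IsZeroSumSeq Set.univ R := by
      rw [hR] at hBz
      exact zs_of_add hBz h1.sum_zeroSum.2
    obtain ⟨F3, h3, h3s⟩ := exists_fac hRz
    have := hBc k (F1 + F3) (F2 + F3) ((up _ h1).add h3) ((up _ h2).add h3)
      (by rw [Multiset.sum_add, h3s, hR]) (by rw [Multiset.sum_add, h3s, hR, he])
    rw [Multiset.card_add, Multiset.card_add] at this
    push_cast at this
    rwa [add_sub_add_right_eq_sub] at this
  refine ⟨G0, ?_, hL⟩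
  intro hempty
  have hhf : ∀ A, IsMinZeroSum G0 A → kap n A = n := by
    intro A hA
    obtain ⟨F, h1, h2, h3⟩ := npow_fac hn A hA.2.1
    obtain ⟨k1, k2⟩ := fac_nsmul hA n
    have kc : Multiset.card (Multiset.replicate n A) = n := by simp
    rcases lt_trichotomy (kap n A) n with h | h | h
    · obtain ⟨δ, hδ, -⟩ := exists_dist h1 k1 (by rw [h2, k2]) (by omega)
      rw [hempty] at hδ
      exact absurd hδ (Set.notMem_empty _)
    · exact h
    · obtain ⟨δ, hδ, -⟩ := exists_dist k1 h1 (by rw [h2, k2]) (by omega)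
      rw [hempty] at hδ
      exact absurd hδ (Set.notMem_empty _)
  have hbd : ∀ g, ∃ c, g ∉ G0 → ∀ᶠ k in (𝒰 : Filter ℕ), (B k).count g ≤ c := by
    intro g
    by_cases hg : g ∈ G0
    · exact ⟨0, fun h => absurd hg h⟩
    · have : ∃ c, ¬ ∀ᶠ k in (𝒰 : Filter ℕ), c ≤ (B k).count g := by
        by_contra hcon
        push Not at hcon
        exact hg hcon
      obtain ⟨c, hc⟩ := this
      refine ⟨c, fun _ => ?_⟩
      filter_upwards [Ultrafilter.eventually_not.2 hc] with k hk
      omega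
  choose c hc using hbd
  set C := ∑ g, c g with hC
  have hev : ∀ᶠ k in (𝒰 : Filter ℕ), ∀ g, g ∉ G0 → (B k).count g ≤ c g := by
    rw [Filter.eventually_all]
    intro g
    by_cases hg : g ∈ G0
    · exact Filter.Eventually.of_forall fun _ h => absurd hg h
    · filter_upwards [hc g hg] with k hk _ using hk
  have hlarge : ∀ᶠ k in (𝒰 : Filter ℕ), C * Fintype.card G + C < k :=
    Nat.hyperfilter_le_atTop (Filter.eventually_gt_atTop _)
  obtain ⟨k, hk1, hk2⟩ := (hev.and hlarge).exists
  have hbadC : Multiset.card ((B k).filter (fun g => g ∉ G0)) ≤ C := by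
    rw [← Multiset.sum_count_eq_card (s := Finset.univ) (fun a _ => Finset.mem_univ a), hC]
    refine Finset.sum_le_sum fun g _ => ?_
    rw [Multiset.count_filter]
    by_cases h : g ∈ G0
    · simp [h]
    · simpa [h] using hk1 g h
  have hsplit : ∀ F, AllAtoms Set.univ F → F.sum = B k → ∃ a b e : ℕ,
      Multiset.card F = a + b ∧ b ≤ C ∧ kap n (B k) = a * n + e ∧
        e ≤ b * (Fintype.card G * n) := by
    intro F hF hFs
    set P := F.filter (fun U => ∀ g ∈ U, g ∈ G0) with hP
    set R := F.filter (fun U => ¬ ∀ g ∈ U, g ∈ G0) with hR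
    have hPR : P + R = F := Multiset.filter_add_not _ F
    refine ⟨Multiset.card P, Multiset.card R, kap n R.sum, ?_, ?_, ?_, ?_⟩
    · rw [← Multiset.card_add, hPR]
    · refine (card_bad_le (G0 := G0) ?_).trans (le_trans (Multiset.card_le_card
        (Multiset.filter_le_filter _ ?_)) hbadC)
      · intro U hU
        have := (Multiset.mem_filter.1 hU).2
        push Not at this
        exact this
      · rw [← hFs, ← hPR, Multiset.sum_add]
        exact Multiset.le_add_left _ _
    · rw [← hFs, ← hPR, Multiset.sum_add, kap_add]
      congr 1
      refine kap_fac_eq fun U hU => ?_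
      obtain ⟨u1, u2⟩ := Multiset.mem_filter.1 hU
      exact hhf U ((hF U u1).mono u2)
    · exact kap_fac_le fun U hU =>
        atom_kap_bound hn (hF U (Multiset.mem_filter.1 hU).1)
  obtain ⟨F1, F2, f1, f2, e1, e2, hlt⟩ := hBs k
  obtain ⟨a1, b1, x1, p1, p2, p3, p4⟩ := hsplit F1 f1 e1
  obtain ⟨a2, b2, x2, q1, q2, q3, q4⟩ := hsplit F2 f2 e2
  have h1 : a2 * n ≤ (a1 + C * Fintype.card G) * n := by
    have : b1 * (Fintype.card G * n) ≤ C * (Fintype.card G * n) := Nat.mul_le_mul_right _ p2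
    rw [add_mul, mul_assoc]
    omega
  have h2 := Nat.le_of_mul_le_mul_right h1 (by omega)
  omega

/-! ### Conclusion -/

theorem rhoStar_eq [Fintype G] {n d r : ℕ} (hn1 : 1 < n) (hn : ∀ g : G, n • g = 0)
    (hdn : n / 2 ≤ d) (hrd : r ≤ d) (γ : G → Fin r → ℤ)
    (hγ : ∀ (S : Finset G) (x : S → ℤ), (∀ j, ∑ g : S, x g * γ g j = 0) →
      ∑ g : S, x g • (g : G) = 0)
    (hd : d ∈ delta1 G) : rhoStar G d = (n : ℝ) / ((n : ℝ) - (d : ℝ)) := by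
  have hall : ∀ G0 : Set G, deltaG0 G0 ≠ ∅ → LenCong G0 d →
      rhoG0 G0 = (n : ℝ) / ((n : ℝ) - (d : ℝ)) := fun G0 hne hL =>
    rho_eq hn1 hn hdn hL hne fun A hA => atom_kap_le hn1 hn hdn hrd γ hγ hL hA
  obtain ⟨G0, hne, hL⟩ := exists_of_delta1 hn1 hn hd
  refine IsGreatest.csSup_eq ⟨⟨G0, hne, dvd_of_lenCong hL hne, (hall G0 hne hL).symm⟩, ?_⟩
  rintro x ⟨G1, hne1, hd1, rfl⟩
  exact (hall G1 hne1 (lenCong_of_dvd hne1 hd1)).le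

theorem lift_exists {r : ℕ} (n : Fin r → ℕ) (e : G ≃+ (∀ i : Fin r, ZMod (n i))) :
    ∃ γ : G → Fin r → ℤ, ∀ (S : Finset G) (x : S → ℤ), (∀ j, ∑ g : S, x g * γ g j = 0) →
      ∑ g : S, x g • (g : G) = 0 := by
  refine ⟨fun g j => ((e g j).cast : ℤ), fun S x h => ?_⟩
  apply e.injective
  rw [map_zero, map_sum]
  funext j
  have := congrArg (fun z : ℤ => (z : ZMod (n j))) (h j)
  simp only [Int.cast_sum, Int.cast_mul, ZMod.intCast_cast, ZMod.cast_id', id, Int.cast_zero] at this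
  rw [Finset.sum_apply]
  simp only [map_zsmul, Pi.smul_apply, zsmul_eq_mul]
  exact this

end Aux

/-- If `G ≅ C_{n₁} ⊕ … ⊕ C_{n_r}` with `1 < n₁ ∣ … ∣ n_r`,
`D(G) ≥ 4`, `d ∈ Δ₁(G)`, `d ≥ max {⌊n_r/2⌋, ⌊(r+1)/2⌋}` and `d ≥ r`, then
`ρ*(G, d) = n_r/(n_r − d)`. -/
theorem stmt7 {G : Type*} [AddCommGroup G] [Fintype G]
    (r : ℕ) (hr : 0 < r) (n : Fin r → ℕ) (hn : ∀ i, 1 < n i)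
    (hdvd : ∀ i j : Fin r, i ≤ j → n i ∣ n j)
    (hG : Nonempty (G ≃+ (∀ i : Fin r, ZMod (n i))))
    (hD : 4 ≤ davenport G)
    (d : ℕ) (hd : d ∈ delta1 G)
    (hd1 : max (n ⟨r - 1, by omega⟩ / 2) ((r + 1) / 2) ≤ d) (hd2 : r ≤ d) :
    rhoStar G d = (n ⟨r - 1, by omega⟩ : ℝ) / ((n ⟨r - 1, by omega⟩ : ℝ) - (d : ℝ)) := by
  obtain ⟨e⟩ := hG
  obtain ⟨γ, hγ⟩ := lift_exists n e
  refine rhoStar_eq (hn _) ?_ ((le_max_left _ _).trans hd1) hd2 γ hγ hd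
  intro g
  apply e.injective
  rw [map_nsmul, map_zero]
  funext i
  have hi : n i ∣ n ⟨r - 1, by omega⟩ := hdvd i _ (by
    rw [Fin.le_def]
    have := i.2
    change i.1 ≤ r - 1
    omega)
  rw [Pi.smul_apply, nsmul_eq_mul, (ZMod.natCast_eq_zero_iff _ _).2 hi, zero_mul]
  rfl
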